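/- arXiv:2408.10224 — 2 statements merged into one kernel-verified Lean document; each statement's English description precedes it below -/
import Mathlib

section
/- The Groenewold commutator identity holds on 𝒮(ℝ, ℂ): (1/(9iℏ)) [x̂³, p̂³] = x̂² p̂² − 2iℏ x̂ p̂ − (2/3)ℏ²·id, i.e. [x̂³, p̂³] = 9iℏ x̂² p̂² + 18ℏ² x̂ p̂ − 6iℏ³·id. (This is the quantization of x²p² obtained from the Poisson bracket {x³, p³} = 9 x²p² via the Dirac correspondence.) -/
open SchwartzMap

/-- In an algebra over a commutative ring, if `a * b - b * a = c • 1`, then `[a³, b³]` is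
a combination of `a² b²`, `a b` and `1`. -/
theorem pow_three_commutator_of_canonical {R A : Type*} [CommRing R] [Ring A] [Algebra R A]
    {a b : A} {c : R} (h : a * b - b * a = c • (1 : A)) :
    a ^ 3 * b ^ 3 - b ^ 3 * a ^ 3 =
      (9 * c) • (a ^ 2 * b ^ 2) - (18 * c ^ 2) • (a * b) + (6 * c ^ 3) • (1 : A) := by
  have h1 : b * a = a * b - c • (1 : A) := by rw [← h]; abel
  have h2 : b * a ^ 2 = a ^ 2 * b - (2 * c) • a := by
    rw [pow_two, ← mul_assoc, h1, sub_mul, mul_assoc, h1, mul_sub, smul_mul_assoc, one_mul,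
      mul_smul_comm, mul_one, ← mul_assoc]
    module
  have h3 : b * a ^ 3 = a ^ 3 * b - (3 * c) • a ^ 2 := by
    rw [pow_succ a 2, ← mul_assoc, h2, sub_mul, mul_assoc, h1, mul_sub, smul_mul_assoc,
      mul_smul_comm, mul_one, ← mul_assoc, ← pow_two]
    module
  have h4 : b ^ 2 * a ^ 3 = a ^ 3 * b ^ 2 - (6 * c) • (a ^ 2 * b) + (6 * c ^ 2) • a := by
    rw [pow_two b, mul_assoc, h3, mul_sub, ← mul_assoc, h3, mul_smul_comm, h2, sub_mul,
      smul_mul_assoc, mul_assoc]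
    module
  have h5 : b ^ 3 * a ^ 3 = a ^ 3 * b ^ 3 - (9 * c) • (a ^ 2 * b ^ 2)
      + (18 * c ^ 2) • (a * b) - (6 * c ^ 3) • (1 : A) := by
    rw [pow_succ' b 2, mul_assoc, h4, mul_add, mul_sub, ← mul_assoc, h3, mul_smul_comm,
      mul_smul_comm, ← mul_assoc, h2, h1, sub_mul, sub_mul, smul_mul_assoc, smul_mul_assoc,
      mul_assoc, mul_assoc, ← pow_two, ← pow_succ']
    module
  rw [h5]
  abel

/-- The canonical commutation relation `[x̂, p̂] = iℏ·id` on Schwartz space. -/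
theorem SchwartzMap.position_momentum_commutator (ℏ : ℝ) (X P : 𝓢(ℝ, ℂ) →L[ℂ] 𝓢(ℝ, ℂ))
    (hX : ∀ (f : 𝓢(ℝ, ℂ)) (x : ℝ), X f x = x * f x)
    (hP : ∀ (f : 𝓢(ℝ, ℂ)) (x : ℝ), P f x = -(Complex.I * ℏ) * deriv (⇑f) x) :
    X * P - P * X = (Complex.I * (ℏ : ℂ)) • (1 : 𝓢(ℝ, ℂ) →L[ℂ] 𝓢(ℝ, ℂ)) := by
  ext f x
  have hd : deriv (⇑(X f)) x = f x + x * deriv (⇑f) x := by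
    have hXf : ⇑(X f) = (fun y : ℝ => (y : ℂ)) * ⇑f := funext (hX f)
    rw [hXf]
    simpa using ((hasDerivAt_id x).ofReal_comp.mul f.differentiableAt.hasDerivAt).deriv
  change X (P f) x - P (X f) x = (Complex.I * (ℏ : ℂ)) * f x
  rw [hX, hP, hP, hd]
  ring

set_option synthInstance.maxHeartbeats 1000000 in
/-- The Groenewold commutator identity:
`(1/(9iℏ))[x̂³, p̂³] = x̂²p̂² − 2iℏ x̂p̂ − (2/3)ℏ²·id`, i.e.
`[x̂³, p̂³] = 9iℏ x̂²p̂² + 18ℏ² x̂p̂ − 6iℏ³·id`. -/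
theorem groenewold_commutator_identity (ℏ : ℝ) (hℏ : 0 < ℏ)
    (X P : 𝓢(ℝ, ℂ) →L[ℂ] 𝓢(ℝ, ℂ))
    (hX : ∀ (f : 𝓢(ℝ, ℂ)) (x : ℝ), X f x = x * f x)
    (hP : ∀ (f : 𝓢(ℝ, ℂ)) (x : ℝ), P f x = -(Complex.I * ℏ) * deriv (⇑f) x) :
    (1 / (9 * Complex.I * (ℏ : ℂ))) • (X ^ 3 * P ^ 3 - P ^ 3 * X ^ 3) =
        X ^ 2 * P ^ 2 - (2 * Complex.I * (ℏ : ℂ)) • (X * P) -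
          ((2 / 3 : ℂ) * (ℏ : ℂ) ^ 2) • (1 : 𝓢(ℝ, ℂ) →L[ℂ] 𝓢(ℝ, ℂ)) ∧
      X ^ 3 * P ^ 3 - P ^ 3 * X ^ 3 =
        (9 * Complex.I * (ℏ : ℂ)) • (X ^ 2 * P ^ 2) +
          (18 * (ℏ : ℂ) ^ 2) • (X * P) -
            (6 * Complex.I * (ℏ : ℂ) ^ 3) • (1 : 𝓢(ℝ, ℂ) →L[ℂ] 𝓢(ℝ, ℂ)) := by
  have hI : Complex.I ^ 2 = -1 := Complex.I_sq
  have key : X ^ 3 * P ^ 3 - P ^ 3 * X ^ 3 =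
      (9 * Complex.I * (ℏ : ℂ)) • (X ^ 2 * P ^ 2) + (18 * (ℏ : ℂ) ^ 2) • (X * P) -
        (6 * Complex.I * (ℏ : ℂ) ^ 3) • (1 : 𝓢(ℝ, ℂ) →L[ℂ] 𝓢(ℝ, ℂ)) := by
    have e2 : 18 * (Complex.I * (ℏ : ℂ)) ^ 2 = -(18 * (ℏ : ℂ) ^ 2) := by
      linear_combination 18 * (ℏ : ℂ) ^ 2 * hI
    have e3 : 6 * (Complex.I * (ℏ : ℂ)) ^ 3 = -(6 * Complex.I * (ℏ : ℂ) ^ 3) := by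
      linear_combination 6 * Complex.I * (ℏ : ℂ) ^ 3 * hI
    rw [pow_three_commutator_of_canonical
      (SchwartzMap.position_momentum_commutator ℏ X P hX hP), e2, e3, neg_smul, neg_smul,
      sub_neg_eq_add, ← sub_eq_add_neg, ← mul_assoc]
  refine ⟨?_, key⟩
  have h0 : (ℏ : ℂ) ≠ 0 := Complex.ofReal_ne_zero.mpr hℏ.ne'
  have c1 : 1 / (9 * Complex.I * (ℏ : ℂ)) * (9 * Complex.I * (ℏ : ℂ)) = 1 :=
    one_div_mul_cancel (by simp [h0])
  have c2 : 1 / (9 * Complex.I * (ℏ : ℂ)) * (18 * (ℏ : ℂ) ^ 2) =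
      -(2 * Complex.I * (ℏ : ℂ)) := by
    linear_combination -(2 * Complex.I * (ℏ : ℂ)) * c1 +
      1 / (9 * Complex.I * (ℏ : ℂ)) * 18 * (ℏ : ℂ) ^ 2 * hI
  have c3 : 1 / (9 * Complex.I * (ℏ : ℂ)) * (6 * Complex.I * (ℏ : ℂ) ^ 3) =
      (2 / 3 : ℂ) * (ℏ : ℂ) ^ 2 := by
    linear_combination (2 / 3 : ℂ) * (ℏ : ℂ) ^ 2 * c1
  rw [key, smul_sub, smul_add, smul_smul, smul_smul, smul_smul, c1, c2, c3, one_smul, neg_smul,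
    ← sub_eq_add_neg]
end

section
/- In dimension four, the Born–Jordan quantization of the squared angular momentum l² = (1/2) Σ_{i,j=1}^{4} l_{ij}² = Σ_{1≤i<j≤4} l_{ij}² exceeds l̂² by 4ℏ²: as operators on 𝒮(ℝ⁴, ℂ), Σ_{1≤i<j≤4} [ x̂_i² p̂_j² + x̂_j² p̂_i² − (2/3) x̂_ip̂_ix̂_jp̂_j − (1/3) x̂_ip̂_ip̂_jx̂_j − (1/3) p̂_ix̂_ix̂_jp̂_j − (2/3) p̂_ix̂_ip̂_jx̂_j ] = l̂² + 4ℏ²·id, where l̂² = Σ_{1≤i<j≤4} l̂_{ij}² and l̂_{ij} = x̂_ip̂_j − x̂_jp̂_i. -/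
open SchwartzMap Finset

set_option synthInstance.maxHeartbeats 1000000

/-- The Born–Jordan quantization of `l_{ij}² = (x_i p_j − x_j p_i)²` in one
conjugate pair of indices in dimension four. -/
noncomputable def bjTermL2Four
    (X P : Fin 4 → (𝓢(EuclideanSpace ℝ (Fin 4), ℂ) →L[ℂ] 𝓢(EuclideanSpace ℝ (Fin 4), ℂ)))
    (i j : Fin 4) : 𝓢(EuclideanSpace ℝ (Fin 4), ℂ) →L[ℂ] 𝓢(EuclideanSpace ℝ (Fin 4), ℂ) :=
  (X i) ^ 2 * (P j) ^ 2 + (X j) ^ 2 * (P i) ^ 2 -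
    (2 / 3 : ℂ) • (X i * P i * X j * P j) - (1 / 3 : ℂ) • (X i * P i * P j * X j) -
    (1 / 3 : ℂ) • (P i * X i * X j * P j) - (2 / 3 : ℂ) • (P i * X i * P j * X j)

/-- For two conjugate pairs with `[x, p] = [y, q] = c`, the Born–Jordan quantization of
`(x q - y p)²` differs from `(x q - y p) ^ 2` by `-(2 / 3) c²`. -/
theorem bornJordan_sub_sq_of_commutator {A : Type*} [Ring A] [Algebra ℂ A]
    {x y p q : A} {c : ℂ} (hxy : y * x = x * y) (hpq : q * p = p * q)
    (hpy : p * y = y * p) (hqx : q * x = x * q)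
    (hpx : p * x = x * p - c • 1) (hqy : q * y = y * q - c • 1) :
    x ^ 2 * q ^ 2 + y ^ 2 * p ^ 2 - (2 / 3 : ℂ) • (x * p * y * q) -
        (1 / 3 : ℂ) • (x * p * q * y) - (1 / 3 : ℂ) • (p * x * y * q) -
        (2 / 3 : ℂ) • (p * x * q * y) =
      (x * q - y * p) ^ 2 + (-(2 / 3) * c ^ 2) • 1 := by
  have hxy' (z : A) : y * (x * z) = x * (y * z) := by simp only [← mul_assoc, hxy]
  have hpy' (z : A) : p * (y * z) = y * (p * z) := by simp only [← mul_assoc, hpy]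
  have hqx' (z : A) : q * (x * z) = x * (q * z) := by simp only [← mul_assoc, hqx]
  have hpx' (z : A) : p * (x * z) = x * (p * z) - c • z := by
    rw [← mul_assoc, hpx, sub_mul, smul_mul_assoc, one_mul, mul_assoc]
  have hqy' (z : A) : q * (y * z) = y * (q * z) - c • z := by
    rw [← mul_assoc, hqy, sub_mul, smul_mul_assoc, one_mul, mul_assoc]
  simp only [pow_two, mul_sub, sub_mul, mul_assoc, hxy', hpq, hpy, hpy', hqx', hpx, hpx',
    hqy, hqy', mul_smul_comm, smul_mul_assoc, mul_one, one_mul]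
  module

open scoped LineDeriv in
theorem SchwartzMap.lineDerivOp_comm {E F : Type*} [NormedAddCommGroup E] [NormedSpace ℝ E]
    [NormedAddCommGroup F] [NormedSpace ℝ F] (f : 𝓢(E, F)) (v w : E) :
    ∂_{v} (∂_{w} f) = (∂_{w} (∂_{v} f) : 𝓢(E, F)) := by
  ext x
  have hd : DifferentiableAt ℝ (fderiv ℝ f) x :=
    ((f.smooth 2).fderiv_right (m := 1) (by norm_num)).differentiable (by norm_num) x
  have key (u u' : E) : ∂_{u} (∂_{u'} f : 𝓢(E, F)) x =
      fderiv ℝ (fderiv ℝ f) x u u' := by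
    have h : ⇑(∂_{u'} f : 𝓢(E, F)) = fun y ↦ fderiv ℝ f y u' :=
      funext fun y ↦ lineDerivOp_apply_eq_fderiv u' f y
    rw [lineDerivOp_apply_eq_fderiv, h, fderiv_clm_apply hd (differentiableAt_const _)]
    simp
  rw [key, key]
  exact second_derivative_symmetric (fun y ↦ f.differentiableAt.hasFDerivAt) hd.hasFDerivAt v w

section CanonicalCommutation

variable {ι : Type*} [Fintype ι] {κ : ℂ}
  {X P : ι → (𝓢(EuclideanSpace ℝ ι, ℂ) →L[ℂ] 𝓢(EuclideanSpace ℝ ι, ℂ))}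

theorem position_mul_comm
    (hX : ∀ (j : ι) (f : 𝓢(EuclideanSpace ℝ ι, ℂ)) (x : EuclideanSpace ℝ ι),
      X j f x = x j * f x) (i j : ι) :
    X i * X j = X j * X i := by
  ext f x
  simp only [ContinuousLinearMap.mul_def, ContinuousLinearMap.comp_apply, hX]
  ring

theorem momentum_mul_comm [DecidableEq ι]
    (hP : ∀ (j : ι) (f : 𝓢(EuclideanSpace ℝ ι, ℂ)) (x : EuclideanSpace ℝ ι),
      P j f x = κ * fderiv ℝ (⇑f) x (EuclideanSpace.single j 1)) (i j : ι) :
    P i * P j = P j * P i := by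
  have h (k : ι) (f : 𝓢(EuclideanSpace ℝ ι, ℂ)) :
      P k f = κ • (LineDeriv.lineDerivOp (EuclideanSpace.single k (1 : ℝ)) f :
        𝓢(EuclideanSpace ℝ ι, ℂ)) := by
    ext x
    simp [hP, lineDerivOp_apply_eq_fderiv]
  ext1 f
  simp only [ContinuousLinearMap.mul_def, ContinuousLinearMap.comp_apply, h,
    LineDeriv.lineDerivOp_smul]
  rw [lineDerivOp_comm]

theorem momentum_mul_position [DecidableEq ι]
    (hX : ∀ (j : ι) (f : 𝓢(EuclideanSpace ℝ ι, ℂ)) (x : EuclideanSpace ℝ ι),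
      X j f x = x j * f x)
    (hP : ∀ (j : ι) (f : 𝓢(EuclideanSpace ℝ ι, ℂ)) (x : EuclideanSpace ℝ ι),
      P j f x = κ * fderiv ℝ (⇑f) x (EuclideanSpace.single j 1)) (i j : ι) :
    P i * X j = X j * P i + (if i = j then κ else 0) • 1 := by
  ext f x
  have hXf : ⇑(X j f) = fun y : EuclideanSpace ℝ ι ↦ (y j) • f y :=
    funext fun y ↦ by rw [hX, Complex.real_smul]
  have hc : HasFDerivAt (fun y : EuclideanSpace ℝ ι ↦ y j)
      (EuclideanSpace.proj j : EuclideanSpace ℝ ι →L[ℝ] ℝ) x :=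
    (EuclideanSpace.proj j : EuclideanSpace ℝ ι →L[ℝ] ℝ).hasFDerivAt
  have hd := (hc.smul f.differentiableAt.hasFDerivAt).fderiv
  simp only [ContinuousLinearMap.mul_def, ContinuousLinearMap.comp_apply, add_apply,
    smul_apply, one_apply_eq_self, hP, hX, hXf]
  erw [hd]
  by_cases h : i = j
  · subst h
    simp
    ring
  · simp [h, Ne.symm h]
    ring

end CanonicalCommutation

/-- In dimension four the Born–Jordan quantization of the squared angular
momentum `l² = Σ_{i<j} l_{ij}²` exceeds `l̂² = Σ_{i<j} (x̂_ip̂_j − x̂_jp̂_i)²` by `4ℏ²`. -/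
theorem born_jordan_quantization_angular_momentum_squared_dim4 (ℏ : ℝ) (hℏ : 0 < ℏ)
    (X P : Fin 4 → (𝓢(EuclideanSpace ℝ (Fin 4), ℂ) →L[ℂ] 𝓢(EuclideanSpace ℝ (Fin 4), ℂ)))
    (hX : ∀ (j : Fin 4) (f : 𝓢(EuclideanSpace ℝ (Fin 4), ℂ)) (x : EuclideanSpace ℝ (Fin 4)),
      X j f x = x j * f x)
    (hP : ∀ (j : Fin 4) (f : 𝓢(EuclideanSpace ℝ (Fin 4), ℂ)) (x : EuclideanSpace ℝ (Fin 4)),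
      P j f x = -(Complex.I * ℏ) * fderiv ℝ (⇑f) x (EuclideanSpace.single j 1)) :
    (∑ q ∈ univ.filter (fun q : Fin 4 × Fin 4 => q.1 < q.2), bjTermL2Four X P q.1 q.2) =
      (∑ q ∈ univ.filter (fun q : Fin 4 × Fin 4 => q.1 < q.2),
          (X q.1 * P q.2 - X q.2 * P q.1) ^ 2) +
        ((4 : ℂ) * (ℏ : ℂ) ^ 2) •
          (1 : 𝓢(EuclideanSpace ℝ (Fin 4), ℂ) →L[ℂ] 𝓢(EuclideanSpace ℝ (Fin 4), ℂ)) := by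
  have hpair (i j : Fin 4) (hij : i < j) : bjTermL2Four X P i j =
      (X i * P j - X j * P i) ^ 2 + (-(2 / 3) * (Complex.I * ℏ) ^ 2) • 1 := by
    have hpx (k l : Fin 4) := momentum_mul_position hX hP k l
    refine bornJordan_sub_sq_of_commutator (position_mul_comm hX j i)
      (momentum_mul_comm hP j i) ?_ ?_ ?_ ?_
    · simpa [hij.ne] using hpx i j
    · simpa [hij.ne'] using hpx j i
    · simpa [sub_eq_add_neg] using hpx i i
    · simpa [sub_eq_add_neg] using hpx j j
  have hcard : #(univ.filter (fun q : Fin 4 × Fin 4 => q.1 < q.2)) = 6 := by decide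
  rw [sum_congr rfl fun q hq ↦ hpair q.1 q.2 (mem_filter.1 hq).2, sum_add_distrib, sum_const,
    hcard, ← Nat.cast_smul_eq_nsmul ℂ, smul_smul]
  congr 2
  rw [mul_pow, Complex.I_sq]
  push_cast
  ring
end
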